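/- There is no positive definite integral quadratic form of rank 7 that represents both the root form A₅ and the form I₂ ⊥ K ⊥ ⟨105⟩, where K is the binary form with matrix (4, 1; 1, 4). (Consequently κ(5,7) = 1.) -/

import Mathlib

open Matrix

/-- A positive definite integral quadratic form of rank `m`. -/
def IsPDForm {m : ℕ} (M : Matrix (Fin m) (Fin m) ℤ) : Prop :=
  M.IsSymm ∧ ∀ x : Fin m → ℤ, x ≠ 0 → 0 < x ⬝ᵥ M.mulVec x

/-- `N` is represented by `L` if `Tᵀ L T = N` for some integer matrix `T`. -/
def Represents {n m : ℕ} (L : Matrix (Fin n) (Fin n) ℤ)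
    (N : Matrix (Fin m) (Fin m) ℤ) : Prop :=
  ∃ T : Matrix (Fin n) (Fin m) ℤ, Tᵀ * L * T = N

/-- An integer `a` is represented by the form `M`. -/
def RepresentsInt {m : ℕ} (M : Matrix (Fin m) (Fin m) ℤ) (a : ℤ) : Prop :=
  ∃ x : Fin m → ℤ, x ⬝ᵥ M.mulVec x = a

/-- Two integral forms of rank `n` are isometric. -/
def IsomForm {n : ℕ} (A B : Matrix (Fin n) (Fin n) ℤ) : Prop :=
  ∃ U : Matrix (Fin n) (Fin n) ℤ, IsUnit U.det ∧ Uᵀ * A * U = B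


/-- The Gram matrix of the root lattice A₅. -/
def A5 : Matrix (Fin 5) (Fin 5) ℤ :=
  !![2, -1, 0, 0, 0;
     -1, 2, -1, 0, 0;
     0, -1, 2, -1, 0;
     0, 0, -1, 2, -1;
     0, 0, 0, -1, 2]

/-- The form I₂ ⊥ K ⊥ ⟨105⟩, where K = (4, 1; 1, 4). -/
def ell2 : Matrix (Fin 5) (Fin 5) ℤ :=
  !![1, 0, 0, 0, 0;
     0, 1, 0, 0, 0;
     0, 0, 4, 1, 0;
     0, 0, 1, 4, 0;
     0, 0, 0, 0, 105]

/-! ### Numerical part -/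

lemma sq_cases (x : ℤ) (h : x ^ 2 ≤ 4) : x = 0 ∨ x ^ 2 = 1 ∨ (x ^ 2 = 4 ∧ Even x) := by
  have h1 : -2 ≤ x := by nlinarith
  have h2 : x ≤ 2 := by nlinarith
  interval_cases x <;> simp

lemma odd_of_sq {x : ℤ} (h : x ^ 2 = 1) : Odd x := by
  rcases (sq_eq_sq_iff_eq_or_eq_neg.mp (h.trans (one_pow 2).symm)) with h | h <;> subst h <;> decide

/-- Five integers with squares summing to `105`, the first two odd. -/
lemma five (a b c d e : ℤ) (ha : Odd a) (hb : Odd b)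
    (h : a ^ 2 + b ^ 2 + c ^ 2 + d ^ 2 + e ^ 2 = 105) : False := by
  have o : ∀ x : ℤ, x ^ 2 % 8 = 0 ∨ x ^ 2 % 8 = 1 ∨ x ^ 2 % 8 = 4 := by
    intro x
    have : x % 8 = 0 ∨ x % 8 = 1 ∨ x % 8 = 2 ∨ x % 8 = 3 ∨ x % 8 = 4 ∨ x % 8 = 5 ∨
      x % 8 = 6 ∨ x % 8 = 7 := by omega
    rcases this with h | h | h | h | h | h | h | h <;> simp [pow_two, Int.mul_emod, h]
  have ha' := Int.sq_mod_four_eq_one_of_odd ha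
  have hb' := Int.sq_mod_four_eq_one_of_odd hb
  rcases o a with h1 | h1 | h1 <;> rcases o b with h2 | h2 | h2 <;>
  rcases o c with h3 | h3 | h3 <;> rcases o d with h4 | h4 | h4 <;>
  rcases o e with h5 | h5 | h5 <;> omega

/-- The case `a = 1`: two parity conditions. -/
lemma five' (a b c d e : ℤ) (h1 : Even (a + c + d + e)) (h2 : Even (b + c + d + e))
    (h : a ^ 2 + b ^ 2 + c ^ 2 + d ^ 2 + e ^ 2 = 105) : False := by
  have p : Odd (a ^ 2 + b ^ 2 + c ^ 2 + d ^ 2 + e ^ 2) := by rw [h]; decide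
  have ho : Odd a ∧ Odd b := by
    simp only [← Int.not_even_iff_odd, Int.even_add, Int.even_pow] at *
    by_cases ha : Even a <;> by_cases hb : Even b <;> by_cases hc : Even c <;>
    by_cases hd : Even d <;> by_cases he : Even e <;> simp_all
  exact five a b c d e ho.1 ho.2 h

/-- The case `a = 2`. -/
lemma two (s t u zi zj zk zl g : ℤ) (hs : s ^ 2 = 1) (ht : t ^ 2 = 1) (hu : u ^ 2 = 1)
    (h1 : s * zi + t * zj = -(2 * g)) (h2 : -s * zi + u * zk = -(2 * g))
    (h : zi ^ 2 + zj ^ 2 + zk ^ 2 + zl ^ 2 + 2 * g ^ 2 = 105) : False := by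
  have e1 : zj ^ 2 = (2 * g + s * zi) ^ 2 := by
    have : t * zj = -(2 * g + s * zi) := by linarith
    calc zj ^ 2 = (t * zj) ^ 2 := by rw [mul_pow, ht, one_mul]
      _ = _ := by rw [this]; ring
  have e2 : zk ^ 2 = (2 * g - s * zi) ^ 2 := by
    have : u * zk = -(2 * g - s * zi) := by linarith
    calc zk ^ 2 = (u * zk) ^ 2 := by rw [mul_pow, hu, one_mul]
      _ = _ := by rw [this]; ring
  have key : 3 * zi ^ 2 + 10 * g ^ 2 + zl ^ 2 = 105 := by
    rw [e1, e2] at h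
    linear_combination h - 2 * zi ^ 2 * hs
  have o : ∀ x : ℤ, x ^ 2 % 3 = 1 ∨ (3 ∣ x ∧ x ^ 2 % 9 = 0) := by
    intro x
    have : x % 9 = 0 ∨ x % 9 = 3 ∨ x % 9 = 6 ∨ x % 3 = 1 ∨ x % 3 = 2 := by omega
    rcases this with h | h | h | h | h
    · right; exact ⟨by omega, by simp [pow_two, Int.mul_emod, h]⟩
    · right; exact ⟨by omega, by simp [pow_two, Int.mul_emod, h]⟩
    · right; exact ⟨by omega, by simp [pow_two, Int.mul_emod, h]⟩
    · left; simp [pow_two, Int.mul_emod, h]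
    · left; simp [pow_two, Int.mul_emod, h]
  rcases o zi with h3 | ⟨_, h3⟩ <;> rcases o g with h4 | ⟨_, h4⟩ <;>
    rcases o zl with h5 | ⟨_, h5⟩ <;> omega

/-- The case `a = 3`. -/
lemma three (x y z w a b c d g : ℤ) (hx : x ^ 2 = 1) (hy : y ^ 2 = 1) (hz : z ^ 2 = 1)
    (hw : w ^ 2 = 1) (h1 : x * a + y * b + z * c + w * d = 0) (h2 : a ^ 2 = 9 * g ^ 2)
    (h : a ^ 2 + b ^ 2 + c ^ 2 + d ^ 2 + 3 * g ^ 2 = 105) : False := by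
  have h3 : x * a = 3 * g ∨ x * a = -(3 * g) := by
    apply sq_eq_sq_iff_eq_or_eq_neg.mp
    rw [mul_pow, hx, h2]; ring
  obtain ⟨G, hG, hG2⟩ : ∃ G : ℤ, x * a = -(3 * G) ∧ G ^ 2 = g ^ 2 := by
    rcases h3 with h3 | h3
    · exact ⟨-g, by linarith, by ring⟩
    · exact ⟨g, h3, rfl⟩
  obtain ⟨A, hA⟩ : ∃ A, A = y * b - G := ⟨_, rfl⟩
  obtain ⟨B, hB⟩ : ∃ B, B = z * c - G := ⟨_, rfl⟩
  have eb : b ^ 2 = (G + A) ^ 2 := by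
    rw [show G + A = y * b by rw [hA]; ring, mul_pow, hy, one_mul]
  have ec : c ^ 2 = (G + B) ^ 2 := by
    rw [show G + B = z * c by rw [hB]; ring, mul_pow, hz, one_mul]
  have ed : d ^ 2 = (G - A - B) ^ 2 := by
    rw [show G - A - B = w * d by rw [hA, hB]; linarith, mul_pow, hw, one_mul]
  have key : 15 * G ^ 2 + 2 * (A ^ 2 + A * B + B ^ 2) = 105 := by
    rw [h2, eb, ec, ed, ← hG2] at h
    linear_combination h
  have hd : 5 ∣ A ∧ 5 ∣ B := by
    have h5 : (A ^ 2 + A * B + B ^ 2) % 5 = 0 := by omega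
    have hA5 : A % 5 = 0 ∨ A % 5 = 1 ∨ A % 5 = 2 ∨ A % 5 = 3 ∨ A % 5 = 4 := by omega
    have hB5 : B % 5 = 0 ∨ B % 5 = 1 ∨ B % 5 = 2 ∨ B % 5 = 3 ∨ B % 5 = 4 := by omega
    rcases hA5 with h6 | h6 | h6 | h6 | h6 <;> rcases hB5 with h7 | h7 | h7 | h7 | h7 <;>
      simp [pow_two, Int.add_emod, Int.mul_emod, h6, h7] at h5
    omega
  obtain ⟨⟨A', rfl⟩, ⟨B', rfl⟩⟩ := hd
  have k2 : 3 * G ^ 2 + 10 * (A' ^ 2 + A' * B' + B' ^ 2) = 21 := by linarith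
  have k3 : (G ^ 2) % 5 = 2 := by omega
  have hG5 : G % 5 = 0 ∨ G % 5 = 1 ∨ G % 5 = 2 ∨ G % 5 = 3 ∨ G % 5 = 4 := by omega
  rcases hG5 with h6 | h6 | h6 | h6 | h6 <;> simp [pow_two, Int.mul_emod, h6] at k3

lemma norm4 (a b c d : ℤ) (h : a ^ 2 + b ^ 2 + c ^ 2 + d ^ 2 = 4) :
    (a ^ 2 = 1 ∧ b ^ 2 = 1 ∧ c ^ 2 = 1 ∧ d ^ 2 = 1) ∨ (Even a ∧ Even b ∧ Even c ∧ Even d) := by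
  have := sq_nonneg a; have := sq_nonneg b; have := sq_nonneg c; have := sq_nonneg d
  rcases sq_cases a (by omega) with ha | ha | ⟨ha, ha'⟩ <;>
  rcases sq_cases b (by omega) with hb | hb | ⟨hb, hb'⟩ <;>
  rcases sq_cases c (by omega) with hc | hc | ⟨hc, hc'⟩ <;>
  rcases sq_cases d (by omega) with hd | hd | ⟨hd, hd'⟩ <;>
  simp_all

lemma norm3 (a b c d : ℤ) (h : a ^ 2 + b ^ 2 + c ^ 2 + d ^ 2 = 3) :
    (a = 0 ∧ b ^ 2 = 1 ∧ c ^ 2 = 1 ∧ d ^ 2 = 1) ∨ (a ^ 2 = 1 ∧ b = 0 ∧ c ^ 2 = 1 ∧ d ^ 2 = 1) ∨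
    (a ^ 2 = 1 ∧ b ^ 2 = 1 ∧ c = 0 ∧ d ^ 2 = 1) ∨ (a ^ 2 = 1 ∧ b ^ 2 = 1 ∧ c ^ 2 = 1 ∧ d = 0) := by
  have := sq_nonneg a; have := sq_nonneg b; have := sq_nonneg c; have := sq_nonneg d
  rcases sq_cases a (by omega) with ha | ha | ⟨ha, ha'⟩ <;>
  rcases sq_cases b (by omega) with hb | hb | ⟨hb, hb'⟩ <;>
  rcases sq_cases c (by omega) with hc | hc | ⟨hc, hc'⟩ <;>
  rcases sq_cases d (by omega) with hd | hd | ⟨hd, hd'⟩ <;>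
  simp_all

lemma norm2 (a b c d : ℤ) (h : a ^ 2 + b ^ 2 + c ^ 2 + d ^ 2 = 2) :
    (a ^ 2 = 1 ∧ b ^ 2 = 1 ∧ c = 0 ∧ d = 0) ∨ (a ^ 2 = 1 ∧ b = 0 ∧ c ^ 2 = 1 ∧ d = 0) ∨
    (a ^ 2 = 1 ∧ b = 0 ∧ c = 0 ∧ d ^ 2 = 1) ∨ (a = 0 ∧ b ^ 2 = 1 ∧ c ^ 2 = 1 ∧ d = 0) ∨
    (a = 0 ∧ b ^ 2 = 1 ∧ c = 0 ∧ d ^ 2 = 1) ∨ (a = 0 ∧ b = 0 ∧ c ^ 2 = 1 ∧ d ^ 2 = 1) := by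
  have := sq_nonneg a; have := sq_nonneg b; have := sq_nonneg c; have := sq_nonneg d
  rcases sq_cases a (by omega) with ha | ha | ⟨ha, ha'⟩ <;>
  rcases sq_cases b (by omega) with hb | hb | ⟨hb, hb'⟩ <;>
  rcases sq_cases c (by omega) with hc | hc | ⟨hc, hc'⟩ <;>
  rcases sq_cases d (by omega) with hd | hd | ⟨hd, hd'⟩ <;>
  simp_all

lemma norm1 (a b c d : ℤ) (h : a ^ 2 + b ^ 2 + c ^ 2 + d ^ 2 = 1) :
    (a ^ 2 = 1 ∧ b = 0 ∧ c = 0 ∧ d = 0) ∨ (a = 0 ∧ b ^ 2 = 1 ∧ c = 0 ∧ d = 0) ∨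
    (a = 0 ∧ b = 0 ∧ c ^ 2 = 1 ∧ d = 0) ∨ (a = 0 ∧ b = 0 ∧ c = 0 ∧ d ^ 2 = 1) := by
  have := sq_nonneg a; have := sq_nonneg b; have := sq_nonneg c; have := sq_nonneg d
  rcases sq_cases a (by omega) with ha | ha | ⟨ha, ha'⟩ <;>
  rcases sq_cases b (by omega) with hb | hb | ⟨hb, hb'⟩ <;>
  rcases sq_cases c (by omega) with hc | hc | ⟨hc, hc'⟩ <;>
  rcases sq_cases d (by omega) with hd | hd | ⟨hd, hd'⟩ <;>
  simp_all

/-- `P = 0`. -/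
lemma caseP0 (x1 x2 x3 x4 y1 y2 y3 y4 z1 z2 z3 z4 Q R s : ℤ)
    (hP : x1 ^ 2 + x2 ^ 2 + x3 ^ 2 + x4 ^ 2 = 4)
    (hQ : Q = 4 - (y1 ^ 2 + y2 ^ 2 + y3 ^ 2 + y4 ^ 2))
    (hR : R = 105 - (z1 ^ 2 + z2 ^ 2 + z3 ^ 2 + z4 ^ 2))
    (Q0 : 0 ≤ Q)
    (hp : x1 * y1 + x2 * y2 + x3 * y3 + x4 * y4 = 1)
    (hq : x1 * z1 + x2 * z2 + x3 * z3 + x4 * z4 = 0)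
    (hs : s = -(y1 * z1 + y2 * z2 + y3 * z3 + y4 * z4))
    (hQR : Q * R = s ^ 2) : False := by
  have := sq_nonneg y1; have := sq_nonneg y2; have := sq_nonneg y3; have := sq_nonneg y4
  rcases norm4 _ _ _ _ hP with ⟨g1, g2, g3, g4⟩ | ⟨⟨a, g1⟩, ⟨b, g2⟩, ⟨c, g3⟩, ⟨d, g4⟩⟩
  swap
  · have : 2 * (a * y1 + b * y2 + c * y3 + d * y4) = 1 := by
      rw [← hp, g1, g2, g3, g4]; ring
    omega
  have o1 := odd_of_sq g1
  have o2 := odd_of_sq g2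
  have o3 := odd_of_sq g3
  have o4 := odd_of_sq g4
  have hev : Even (z1 + z2 + z3 + z4) := by
    have : Even (x1 * z1 + x2 * z2 + x3 * z3 + x4 * z4) := by rw [hq]; simp
    rw [← Int.not_even_iff_odd] at o1 o2 o3 o4
    simpa only [Int.even_add, Int.even_mul, o1, o2, o3, o4, false_or] using this
  have hodd : Odd (4 - Q) := by
    have : Odd (x1 * y1 + x2 * y2 + x3 * y3 + x4 * y4) := by rw [hp]; simp
    have e : 4 - Q = y1 ^ 2 + y2 ^ 2 + y3 ^ 2 + y4 ^ 2 := by omega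
    rw [← Int.not_even_iff_odd] at o1 o2 o3 o4 this ⊢
    rw [e]
    simpa [Int.even_add, Int.even_mul, o1, o2, o3, o4, Int.even_pow] using this
  have hQ13 : Q = 1 ∨ Q = 3 := by
    obtain ⟨m, hm⟩ := hodd
    omega
  rcases hQ13 with h | h
  · have hT : z1 ^ 2 + z2 ^ 2 + z3 ^ 2 + z4 ^ 2 + s ^ 2 = 105 := by rw [h] at hQR; omega
    have hsum : Even (s + (y1 * z1 + y2 * z2 + y3 * z3 + y4 * z4)) := ⟨0, by linarith⟩
    rcases norm3 y1 y2 y3 y4 (by omega) with ⟨k1, k2, k3, k4⟩ | ⟨k1, k2, k3, k4⟩ |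
      ⟨k1, k2, k3, k4⟩ | ⟨k1, k2, k3, k4⟩
    · have o2 := odd_of_sq k2
      have o3 := odd_of_sq k3
      have o4 := odd_of_sq k4
      rw [← Int.not_even_iff_odd] at o2 o3 o4
      refine five' z1 s z2 z3 z4 hev ?_ (by linarith)
      subst k1
      simp only [Int.even_add, Int.even_mul, o2, o3, o4, Even.zero, true_or, false_or, true_iff] at hsum ⊢
      tauto
    · have o2 := odd_of_sq k1
      have o3 := odd_of_sq k3
      have o4 := odd_of_sq k4
      rw [← Int.not_even_iff_odd] at o2 o3 o4
      refine five' z2 s z1 z3 z4 (by convert hev using 1; ring) ?_ (by linarith)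
      subst k2
      simp only [Int.even_add, Int.even_mul, o2, o3, o4, Even.zero, true_or, false_or, iff_true] at hsum ⊢
      tauto
    · have o2 := odd_of_sq k1
      have o3 := odd_of_sq k2
      have o4 := odd_of_sq k4
      rw [← Int.not_even_iff_odd] at o2 o3 o4
      refine five' z3 s z1 z2 z4 (by convert hev using 1; ring) ?_ (by linarith)
      subst k3
      simp only [Int.even_add, Int.even_mul, o2, o3, o4, Even.zero, true_or, false_or, iff_true] at hsum ⊢
      tauto
    · have o2 := odd_of_sq k1
      have o3 := odd_of_sq k2
      have o4 := odd_of_sq k3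
      rw [← Int.not_even_iff_odd] at o2 o3 o4
      refine five' z4 s z1 z2 z3 (by convert hev using 1; ring) ?_ (by linarith)
      subst k4
      simp only [Int.even_add, Int.even_mul, o2, o3, o4, Even.zero, true_or, false_or, iff_true] at hsum ⊢
      tauto
  · subst h
    have h3 : (3 : ℤ) ∣ s := by
      have : (3 : ℤ) ∣ s ^ 2 := ⟨R, hQR.symm⟩
      exact Int.prime_three.dvd_of_dvd_pow this
    obtain ⟨g, rfl⟩ := h3
    have hRg : R = 3 * g ^ 2 := by linarith
    have fin : ∀ y z : ℤ, y ^ 2 = 1 → 3 * g = -(y * z) → z ^ 2 = 9 * g ^ 2 := by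
      intro y z hy h
      calc z ^ 2 = (-(y * z)) ^ 2 := by rw [neg_sq, mul_pow, hy, one_mul]
        _ = 9 * g ^ 2 := by rw [← h]; ring
    rcases norm1 y1 y2 y3 y4 (by omega) with ⟨k1, k2, k3, k4⟩ | ⟨k1, k2, k3, k4⟩ |
      ⟨k1, k2, k3, k4⟩ | ⟨k1, k2, k3, k4⟩
    · subst k2 k3 k4
      exact three x1 x2 x3 x4 z1 z2 z3 z4 g g1 g2 g3 g4 hq
        (fin y1 _ k1 (by linarith)) (by linarith)
    · subst k1 k3 k4
      exact three x2 x1 x3 x4 z2 z1 z3 z4 g g2 g1 g3 g4 (by linarith)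
        (fin y2 _ k2 (by linarith)) (by linarith)
    · subst k1 k2 k4
      exact three x3 x1 x2 x4 z3 z1 z2 z4 g g3 g1 g2 g4 (by linarith)
        (fin y3 _ k3 (by linarith)) (by linarith)
    · subst k1 k2 k3
      exact three x4 x1 x2 x3 z4 z1 z2 z3 g g4 g1 g2 g3 (by linarith)
        (fin y4 _ k4 (by linarith)) (by linarith)

/-- `P = Q = 1`. -/
lemma case11 (x1 x2 x3 x4 y1 y2 y3 y4 z1 z2 z3 z4 p q s : ℤ)
    (hP : x1 ^ 2 + x2 ^ 2 + x3 ^ 2 + x4 ^ 2 = 3)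
    (hQ : y1 ^ 2 + y2 ^ 2 + y3 ^ 2 + y4 ^ 2 = 3)
    (hR : z1 ^ 2 + z2 ^ 2 + z3 ^ 2 + z4 ^ 2 + q ^ 2 = 105)
    (hp : Odd p) (hp' : x1 * y1 + x2 * y2 + x3 * y3 + x4 * y4 = 1 - p)
    (hq : q = -(x1 * z1 + x2 * z2 + x3 * z3 + x4 * z4))
    (hs : s = -(y1 * z1 + y2 * z2 + y3 * z3 + y4 * z4))
    (hpq : s = p * q) : False := by
  have e1 : Even (q + (x1 * z1 + x2 * z2 + x3 * z3 + x4 * z4)) := ⟨0, by linarith⟩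
  have e2 : Even (q + (y1 * z1 + y2 * z2 + y3 * z3 + y4 * z4)) := by
    have : Even (s + (y1 * z1 + y2 * z2 + y3 * z3 + y4 * z4)) := ⟨0, by linarith⟩
    rw [hpq] at this
    rw [← Int.not_even_iff_odd] at hp
    simpa only [Int.even_add, Int.even_mul, hp, false_or] using this
  have e3 : Even (x1 * y1 + x2 * y2 + x3 * y3 + x4 * y4) := by
    rw [hp']
    exact Odd.sub_odd odd_one hp
  have e4 : (Odd z1 ∧ Even z2 ∧ Even z3 ∧ Even z4 ∧ Even q) ∨
      (Even z1 ∧ Odd z2 ∧ Even z3 ∧ Even z4 ∧ Even q) ∨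
      (Even z1 ∧ Even z2 ∧ Odd z3 ∧ Even z4 ∧ Even q) ∨
      (Even z1 ∧ Even z2 ∧ Even z3 ∧ Odd z4 ∧ Even q) ∨
      (Even z1 ∧ Even z2 ∧ Even z3 ∧ Even z4 ∧ Odd q) := by
    have p : Odd (z1 ^ 2 + z2 ^ 2 + z3 ^ 2 + z4 ^ 2 + q ^ 2) := by rw [hR]; decide
    have f12 := five z1 z2 z3 z4 q
    have f13 := five z1 z3 z2 z4 q
    have f14 := five z1 z4 z2 z3 q
    have f15 := five z1 q z2 z3 z4
    have f23 := five z2 z3 z1 z4 q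
    have f24 := five z2 z4 z1 z3 q
    have f25 := five z2 q z1 z3 z4
    have f34 := five z3 z4 z1 z2 q
    have f35 := five z3 q z1 z2 z4
    have f45 := five z4 q z1 z2 z3
    replace f12 := fun a b => f12 a b (by linarith)
    replace f13 := fun a b => f13 a b (by linarith)
    replace f14 := fun a b => f14 a b (by linarith)
    replace f15 := fun a b => f15 a b (by linarith)
    replace f23 := fun a b => f23 a b (by linarith)
    replace f24 := fun a b => f24 a b (by linarith)
    replace f25 := fun a b => f25 a b (by linarith)
    replace f34 := fun a b => f34 a b (by linarith)
    replace f35 := fun a b => f35 a b (by linarith)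
    replace f45 := fun a b => f45 a b (by linarith)
    clear e1 e2 e3 hR hP hQ hp hp' hq hs hpq
    simp only [← Int.not_even_iff_odd, Int.even_add, Int.even_pow] at *
    by_cases h1 : Even z1 <;> by_cases h2 : Even z2 <;> by_cases h3 : Even z3 <;>
    by_cases h4 : Even z4 <;> by_cases h5 : Even q <;> simp_all
  have od : ∀ {x : ℤ}, x ^ 2 = 1 → ¬ Even x := fun h => Int.not_even_iff_odd.mpr (odd_of_sq h)
  have ev : ∀ {x : ℤ}, x = 0 → Even x := fun h => by simp [h]
  have hx := norm3 _ _ _ _ hP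
  have hy := norm3 _ _ _ _ hQ
  clear hq hs hpq hp' hp hP hQ hR
  simp only [← Int.not_even_iff_odd, Int.even_add, Int.even_mul] at e1 e2 e3 e4
  rcases hx with ⟨k1, k2, k3, k4⟩ | ⟨k1, k2, k3, k4⟩ | ⟨k1, k2, k3, k4⟩ | ⟨k1, k2, k3, k4⟩ <;>
  rcases hy with ⟨l1, l2, l3, l4⟩ | ⟨l1, l2, l3, l4⟩ | ⟨l1, l2, l3, l4⟩ | ⟨l1, l2, l3, l4⟩ <;>
  first
  | replace k1 := od k1
  | replace k1 := ev k1
  all_goals first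
  | replace k2 := od k2
  | replace k2 := ev k2
  all_goals first
  | replace k3 := od k3
  | replace k3 := ev k3
  all_goals first
  | replace k4 := od k4
  | replace k4 := ev k4
  all_goals first
  | replace l1 := od l1
  | replace l1 := ev l1
  all_goals first
  | replace l2 := od l2
  | replace l2 := ev l2
  all_goals first
  | replace l3 := od l3
  | replace l3 := ev l3
  all_goals first
  | replace l4 := od l4
  | replace l4 := ev l4
  all_goals
    simp only [k1, k2, k3, k4, l1, l2, l3, l4, true_or, false_or, or_true, or_false,
      true_iff, iff_true, iff_false, not_true] at e1 e2 e3
  all_goals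
    rcases e4 with ⟨a, b, c, d, e⟩ | ⟨a, b, c, d, e⟩ | ⟨a, b, c, d, e⟩ | ⟨a, b, c, d, e⟩ |
      ⟨a, b, c, d, e⟩ <;> simp_all

/-- `P = Q = 2`. -/
lemma case22 (x1 x2 x3 x4 y1 y2 y3 y4 z1 z2 z3 z4 g : ℤ)
    (hP : x1 ^ 2 + x2 ^ 2 + x3 ^ 2 + x4 ^ 2 = 2)
    (hQ : y1 ^ 2 + y2 ^ 2 + y3 ^ 2 + y4 ^ 2 = 2)
    (hR : z1 ^ 2 + z2 ^ 2 + z3 ^ 2 + z4 ^ 2 + 2 * g ^ 2 = 105)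
    (hp : x1 * y1 + x2 * y2 + x3 * y3 + x4 * y4 = -1)
    (hq : x1 * z1 + x2 * z2 + x3 * z3 + x4 * z4 = -(2 * g))
    (hs : y1 * z1 + y2 * z2 + y3 * z3 + y4 * z4 = -(2 * g)) : False := by
  have same : ∀ a b c d : ℤ, a ^ 2 = 1 → b ^ 2 = 1 → c ^ 2 = 1 → d ^ 2 = 1 →
      a * c + b * d = -1 → False := by
    intro a b c d ha hb hc hd h
    have : Even (a * c + b * d) :=
      ((odd_of_sq ha).mul (odd_of_sq hc)).add_odd ((odd_of_sq hb).mul (odd_of_sq hd))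
    rw [h] at this
    revert this; decide
  have opp : ∀ a c : ℤ, a ^ 2 = 1 → a * c = -1 → c = -a := by
    intro a c ha h
    linear_combination (-c) * ha + a * h
  rcases norm2 _ _ _ _ hP with ⟨a, b, c, d⟩ | ⟨a, b, c, d⟩ | ⟨a, b, c, d⟩ | ⟨a, b, c, d⟩ |
    ⟨a, b, c, d⟩ | ⟨a, b, c, d⟩ <;>
  rcases norm2 _ _ _ _ hQ with ⟨e, f, i, h⟩ | ⟨e, f, i, h⟩ | ⟨e, f, i, h⟩ | ⟨e, f, i, h⟩ |
    ⟨e, f, i, h⟩ | ⟨e, f, i, h⟩ <;>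
  subst_vars <;>
  simp only [zero_mul, mul_zero, zero_add, add_zero] at hp hq hs <;>
  first
  | (exfalso; omega)
  | exact same _ _ _ _ (by assumption) (by assumption) (by assumption) (by assumption) hp
  | (have hc := opp _ _ (by assumption) hp
     subst hc
     have hq' := (add_comm _ _).trans hq
     have hs' := (add_comm _ _).trans hs
     have fin : ∀ s t u zi zj zk zl : ℤ, s * zi + t * zj = -(2 * g) →
        -s * zi + u * zk = -(2 * g) → s ^ 2 = 1 → t ^ 2 = 1 → u ^ 2 = 1 →
        zi ^ 2 + zj ^ 2 + zk ^ 2 + zl ^ 2 + 2 * g ^ 2 = 105 → False :=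
        fun s t u zi zj zk zl h1 h2 h3 h4 h5 h6 => two s t u zi zj zk zl g h3 h4 h5 h1 h2 h6
     first
     | exact fin _ _ _ _ _ _ z1 hq hs (by assumption) (by assumption) (by assumption) (by linarith)
     | exact fin _ _ _ _ _ _ z1 hq hs' (by assumption) (by assumption) (by assumption) (by linarith)
     | exact fin _ _ _ _ _ _ z1 hq' hs (by assumption) (by assumption) (by assumption) (by linarith)
     | exact fin _ _ _ _ _ _ z1 hq' hs' (by assumption) (by assumption) (by assumption) (by linarith)
     | exact fin _ _ _ _ _ _ z2 hq hs (by assumption) (by assumption) (by assumption) (by linarith)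
     | exact fin _ _ _ _ _ _ z2 hq hs' (by assumption) (by assumption) (by assumption) (by linarith)
     | exact fin _ _ _ _ _ _ z2 hq' hs (by assumption) (by assumption) (by assumption) (by linarith)
     | exact fin _ _ _ _ _ _ z2 hq' hs' (by assumption) (by assumption) (by assumption) (by linarith)
     | exact fin _ _ _ _ _ _ z3 hq hs (by assumption) (by assumption) (by assumption) (by linarith)
     | exact fin _ _ _ _ _ _ z3 hq hs' (by assumption) (by assumption) (by assumption) (by linarith)
     | exact fin _ _ _ _ _ _ z3 hq' hs (by assumption) (by assumption) (by assumption) (by linarith)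
     | exact fin _ _ _ _ _ _ z3 hq' hs' (by assumption) (by assumption) (by assumption) (by linarith)
     | exact fin _ _ _ _ _ _ z4 hq hs (by assumption) (by assumption) (by assumption) (by linarith)
     | exact fin _ _ _ _ _ _ z4 hq hs' (by assumption) (by assumption) (by assumption) (by linarith)
     | exact fin _ _ _ _ _ _ z4 hq' hs (by assumption) (by assumption) (by assumption) (by linarith)
     | exact fin _ _ _ _ _ _ z4 hq' hs' (by assumption) (by assumption) (by assumption) (by linarith))

lemma dec_cases : ∀ P ∈ Finset.Icc (1 : ℤ) 4, ∀ Q ∈ Finset.Icc (1 : ℤ) 4,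
    ∀ p ∈ Finset.Icc (-4 : ℤ) 4, P * Q = p ^ 2 → (1 - p) ^ 2 ≤ (4 - P) * (4 - Q) →
    (P = 1 ∧ Q = 1 ∧ Odd p) ∨ (P = 2 ∧ Q = 2 ∧ p = 2) := by decide

set_option maxHeartbeats 2000000 in
/-- The numerical contradiction: `K ⊥ ⟨105⟩` is not represented by `I₄ ⊥ ⟨a⟩`. -/
lemma numeric (x1 x2 x3 x4 y1 y2 y3 y4 z1 z2 z3 z4 P Q R p q s : ℤ)
    (hP : P = 4 - (x1 ^ 2 + x2 ^ 2 + x3 ^ 2 + x4 ^ 2))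
    (hQ : Q = 4 - (y1 ^ 2 + y2 ^ 2 + y3 ^ 2 + y4 ^ 2))
    (hR : R = 105 - (z1 ^ 2 + z2 ^ 2 + z3 ^ 2 + z4 ^ 2))
    (hp : p = 1 - (x1 * y1 + x2 * y2 + x3 * y3 + x4 * y4))
    (hq : q = -(x1 * z1 + x2 * z2 + x3 * z3 + x4 * z4))
    (hs : s = -(y1 * z1 + y2 * z2 + y3 * z3 + y4 * z4))
    (P0 : 0 ≤ P) (Q0 : 0 ≤ Q) (hPQ : P * Q = p ^ 2) (hPR : P * R = q ^ 2) (hQR : Q * R = s ^ 2)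
    (hps : P * s = p * q) : False := by
  have P4 : P ≤ 4 := by
    have := sq_nonneg x1; have := sq_nonneg x2; have := sq_nonneg x3; have := sq_nonneg x4
    omega
  have Q4 : Q ≤ 4 := by
    have := sq_nonneg y1; have := sq_nonneg y2; have := sq_nonneg y3; have := sq_nonneg y4
    omega
  by_cases hP0 : P = 0
  · subst hP0
    have p0 : p = 0 := by simpa using hPQ.symm
    have q0 : q = 0 := by simpa using hPR.symm
    exact caseP0 x1 x2 x3 x4 y1 y2 y3 y4 z1 z2 z3 z4 Q R s (by linarith) hQ hR Q0
      (by linarith) (by linarith) hs hQR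
  by_cases hQ0 : Q = 0
  · subst hQ0
    have p0 : p = 0 := by simpa using hPQ.symm
    have q0 : s = 0 := by simpa using hQR.symm
    exact caseP0 y1 y2 y3 y4 x1 x2 x3 x4 z1 z2 z3 z4 P R q (by linarith) hP hR P0
      (by linarith) (by linarith) hq hPR
  have cs : (1 - p) ^ 2 ≤ (4 - P) * (4 - Q) := by
    have e1 : 1 - p = x1 * y1 + x2 * y2 + x3 * y3 + x4 * y4 := by linarith
    have e2 : 4 - P = x1 ^ 2 + x2 ^ 2 + x3 ^ 2 + x4 ^ 2 := by linarith
    have e3 : 4 - Q = y1 ^ 2 + y2 ^ 2 + y3 ^ 2 + y4 ^ 2 := by linarith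
    rw [e1, e2, e3]
    linarith [sq_nonneg (x1 * y2 - x2 * y1), sq_nonneg (x1 * y3 - x3 * y1),
      sq_nonneg (x1 * y4 - x4 * y1), sq_nonneg (x2 * y3 - x3 * y2),
      sq_nonneg (x2 * y4 - x4 * y2), sq_nonneg (x3 * y4 - x4 * y3)]
  have hp4 : p ≤ 4 := by nlinarith
  have hp4' : -4 ≤ p := by nlinarith
  have fin : (P = 1 ∧ Q = 1 ∧ Odd p) ∨ (P = 2 ∧ Q = 2 ∧ p = 2) := by
    exact dec_cases P (Finset.mem_Icc.mpr ⟨by omega, P4⟩) Q (Finset.mem_Icc.mpr ⟨by omega, Q4⟩)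
      p (Finset.mem_Icc.mpr ⟨hp4', hp4⟩) hPQ cs
  rcases fin with ⟨rfl, rfl, h⟩ | ⟨rfl, rfl, rfl⟩
  · exact case11 x1 x2 x3 x4 y1 y2 y3 y4 z1 z2 z3 z4 p q s (by linarith) (by linarith)
      (by linarith) h (by linarith) hq hs (by linarith)
  · have hsq : s = q := by linarith
    have : (2 : ℤ) ∣ q := Int.prime_two.dvd_of_dvd_pow ⟨R, hPR.symm⟩
    obtain ⟨g, rfl⟩ := this
    exact case22 x1 x2 x3 x4 y1 y2 y3 y4 z1 z2 z3 z4 g (by linarith) (by linarith)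
      (by linarith) (by linarith) (by linarith) (by linarith)

/-! ### Lattice part -/

section Lattice

variable {V : Type*} [AddCommGroup V] (B : LinearMap.BilinForm ℤ V)

/-- Symmetric and positive definite. -/
structure PD (B : LinearMap.BilinForm ℤ V) : Prop where
  symm : ∀ x y, B x y = B y x
  pos : ∀ x, x ≠ 0 → 0 < B x x

variable {B}

lemma PD.nonneg (h : PD B) (x : V) : 0 ≤ B x x := by
  by_cases hx : x = 0
  · simp [hx]
  · exact (h.pos x hx).le

lemma PD.eq_zero (h : PD B) {x : V} (hx : B x x = 0) : x = 0 := by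
  by_contra hn
  exact (h.pos x hn).ne' hx

/-- Inner products of unit vectors with roots. -/
lemma PD.unit_root (h : PD B) {u r : V} (hu : B u u = 1) (hr : B r r = 2) :
    B u r = -1 ∨ B u r = 0 ∨ B u r = 1 := by
  have h1 := h.nonneg (r - (2 : ℤ) • u)
  have h2 := h.nonneg (r + (2 : ℤ) • u)
  have := h.symm r u
  simp only [map_add, map_sub, LinearMap.add_apply, LinearMap.sub_apply, map_smul,
    LinearMap.smul_apply, smul_eq_mul] at h1 h2
  omega

lemma PD.unit_unit (h : PD B) {u v : V} (hu : B u u = 1) (hv : B v v = 1) :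
    B u v = 0 ∨ v = u ∨ v = -u := by
  have h1 := h.nonneg (v - u)
  have h2 := h.nonneg (v + u)
  have h3 := @PD.eq_zero _ _ _ h (v - u)
  have h4 := @PD.eq_zero _ _ _ h (v + u)
  have := h.symm v u
  simp only [map_add, map_sub, LinearMap.add_apply, LinearMap.sub_apply] at h1 h2 h3 h4
  have : B u v = 0 ∨ B u v = 1 ∨ B u v = -1 := by omega
  rcases this with h5 | h5 | h5
  · exact Or.inl h5
  · right; left; exact sub_eq_zero.mp (h3 (by omega))
  · right; right; exact eq_neg_of_add_eq_zero_left (h4 (by omega))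

/-- A root which is not orthogonal to some unit vector. -/
def Split (B : LinearMap.BilinForm ℤ V) (r : V) : Prop := ∃ u, B u u = 1 ∧ B u r ≠ 0

lemma Split.exists (h : PD B) {r : V} (hr : B r r = 2) (hs : Split B r) :
    ∃ a b, B a a = 1 ∧ B b b = 1 ∧ B a b = 0 ∧ r = a - b := by
  obtain ⟨u, hu, hur⟩ := hs
  have hc := h.symm r u
  rcases h.unit_root hu hr with h1 | h1 | h1
  · refine ⟨r + u, u, ?_, hu, ?_, by abel⟩ <;>
      simp only [map_add, LinearMap.add_apply] <;> omega
  · exact absurd h1 hur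
  · refine ⟨u, u - r, hu, ?_, ?_, by abel⟩ <;>
      simp only [map_sub, LinearMap.sub_apply] <;> omega

lemma Split.next (h : PD B) {r r' : V} (hr : B r r = 2) (hs : Split B r) (hrr : B r r' = -1) :
    Split B r' := by
  obtain ⟨a, b, ha, hb, -, rfl⟩ := hs.exists h hr
  simp only [map_sub, LinearMap.sub_apply] at hrr
  by_cases h1 : B a r' = 0
  · exact ⟨b, hb, by omega⟩
  · exact ⟨a, ha, h1⟩

/-- Orthonormal families. -/
def ON (B : LinearMap.BilinForm ℤ V) {n : ℕ} (a : Fin n → V) : Prop :=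
  ∀ i j, B (a i) (a j) = if i = j then 1 else 0

/-- The six orthonormal vectors coming from a split root system `A₅`. -/
lemma six (h : PD B) (r1 r2 r3 r4 r5 : V)
    (h11 : B r1 r1 = 2) (h22 : B r2 r2 = 2) (h33 : B r3 r3 = 2) (h44 : B r4 r4 = 2)
    (h55 : B r5 r5 = 2) (h12 : B r1 r2 = -1) (h23 : B r2 r3 = -1) (h34 : B r3 r4 = -1)
    (h45 : B r4 r5 = -1) (h13 : B r1 r3 = 0) (h14 : B r1 r4 = 0) (h15 : B r1 r5 = 0)
    (h24 : B r2 r4 = 0) (h25 : B r2 r5 = 0) (h35 : B r3 r5 = 0)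
    (hs : Split B r1) : ∃ a : Fin 6 → V, ON B a := by
  have step1 : ∃ a1 a2, B a1 a1 = 1 ∧ B a2 a2 = 1 ∧ B a1 a2 = 0 ∧ r1 = a1 - a2 ∧
      B a1 r2 = 0 ∧ B a2 r2 = 1 := by
    obtain ⟨a, b, ha, hb, hab, rfl⟩ := hs.exists h h11
    simp only [map_sub, LinearMap.sub_apply] at h12
    have := h.symm b a
    have c1 := h.unit_root ha h22
    have c2 := h.unit_root hb h22
    have : (B a r2 = 0 ∧ B b r2 = 1) ∨ (B a r2 = -1 ∧ B b r2 = 0) := by omega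
    rcases this with ⟨h1, h2⟩ | ⟨h1, h2⟩
    · exact ⟨a, b, ha, hb, hab, rfl, h1, h2⟩
    · exact ⟨-b, -a, by simpa using hb, by simpa using ha, by simpa [this] using by omega,
        by abel, by simpa using h2, by simp [h1]⟩
  obtain ⟨a1, a2, n1, n2, o12, e1, b1, b2⟩ := step1
  obtain ⟨a3, e3⟩ : ∃ a3, a3 = a2 - r2 := ⟨_, rfl⟩
  have s21 := h.symm a2 a1
  have t2 := h.symm r2 a2
  have n3 : B a3 a3 = 1 := by
    rw [e3]; simp only [map_sub, LinearMap.sub_apply]; omega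
  have o13 : B a1 a3 = 0 := by
    rw [e3]; simp only [map_sub]; omega
  have o23 : B a2 a3 = 0 := by
    rw [e3]; simp only [map_sub]; omega
  have e2 : r2 = a2 - a3 := by rw [e3]; abel
  subst e1 e2
  simp only [map_sub, LinearMap.sub_apply] at *
  -- the third root
  have c1 := h.unit_root n1 h33
  have c2 := h.unit_root n2 h33
  have c3 := h.unit_root n3 h33
  have d3 : B a1 r3 = 0 ∧ B a2 r3 = 0 ∧ B a3 r3 = 1 := by
    by_contra hne
    have d : B a1 r3 = -1 ∧ B a2 r3 = -1 ∧ B a3 r3 = 0 := by omega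
    have hz : r3 + a1 + a2 = 0 := by
      apply h.eq_zero
      have := h.symm r3 a1
      have := h.symm r3 a2
      simp only [map_add, LinearMap.add_apply]
      omega
    have : r3 = - a1 - a2 := by
      have : r3 = (r3 + a1 + a2) - a1 - a2 := by abel
      rw [hz] at this
      rw [this]; abel
    rw [this] at h34
    simp only [map_sub, map_neg, LinearMap.sub_apply, LinearMap.neg_apply] at h34
    omega
  obtain ⟨d31, d32, d33⟩ := d3
  obtain ⟨a4, e4⟩ : ∃ a4, a4 = a3 - r3 := ⟨_, rfl⟩
  have t3 := h.symm r3 a3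
  have n4 : B a4 a4 = 1 := by
    rw [e4]; simp only [map_sub, LinearMap.sub_apply]; omega
  have o14 : B a1 a4 = 0 := by rw [e4]; simp only [map_sub]; omega
  have o24 : B a2 a4 = 0 := by rw [e4]; simp only [map_sub]; omega
  have o34 : B a3 a4 = 0 := by rw [e4]; simp only [map_sub]; omega
  have e3' : r3 = a3 - a4 := by rw [e4]; abel
  subst e3'
  simp only [map_sub, LinearMap.sub_apply] at *
  -- the fourth root
  have bes : ∀ r, B r r = 2 → B a1 r = -1 → B a2 r = -1 → B a3 r = -1 → False := by
    intro r hr h1 h2 h3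
    have := h.nonneg (r + a1 + a2 + a3)
    have := h.symm r a1
    have := h.symm r a2
    have := h.symm r a3
    have := h.symm a3 a1
    have := h.symm a3 a2
    simp only [map_add, LinearMap.add_apply] at *
    omega
  have d4 : B a1 r4 = 0 ∧ B a2 r4 = 0 ∧ B a3 r4 = 0 ∧ B a4 r4 = 1 := by
    have c1 := h.unit_root n1 h44
    have c2 := h.unit_root n2 h44
    have c3 := h.unit_root n3 h44
    have c4 := h.unit_root n4 h44
    have hno : ¬ (B a1 r4 = -1 ∧ B a2 r4 = -1 ∧ B a3 r4 = -1) :=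
      fun ⟨g1, g2, g3⟩ => bes r4 h44 g1 g2 g3
    omega
  obtain ⟨d41, d42, d43, d44⟩ := d4
  obtain ⟨a5, e5⟩ : ∃ a5, a5 = a4 - r4 := ⟨_, rfl⟩
  have t4 := h.symm r4 a4
  have n5 : B a5 a5 = 1 := by
    rw [e5]; simp only [map_sub, LinearMap.sub_apply]; omega
  have o15 : B a1 a5 = 0 := by rw [e5]; simp only [map_sub]; omega
  have o25 : B a2 a5 = 0 := by rw [e5]; simp only [map_sub]; omega
  have o35 : B a3 a5 = 0 := by rw [e5]; simp only [map_sub]; omega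
  have o45 : B a4 a5 = 0 := by rw [e5]; simp only [map_sub]; omega
  have e4' : r4 = a4 - a5 := by rw [e5]; abel
  subst e4'
  simp only [map_sub, LinearMap.sub_apply] at h45
  -- the fifth root
  have d5 : B a1 r5 = 0 ∧ B a2 r5 = 0 ∧ B a3 r5 = 0 ∧ B a4 r5 = 0 ∧ B a5 r5 = 1 := by
    have c1 := h.unit_root n1 h55
    have c2 := h.unit_root n2 h55
    have c3 := h.unit_root n3 h55
    have c4 := h.unit_root n4 h55
    have c5 := h.unit_root n5 h55
    have hno : ¬ (B a1 r5 = -1 ∧ B a2 r5 = -1 ∧ B a3 r5 = -1) :=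
      fun ⟨g1, g2, g3⟩ => bes r5 h55 g1 g2 g3
    omega
  obtain ⟨d51, d52, d53, d54, d55⟩ := d5
  obtain ⟨a6, e6⟩ : ∃ a6, a6 = a5 - r5 := ⟨_, rfl⟩
  have t5 := h.symm r5 a5
  have n6 : B a6 a6 = 1 := by
    rw [e6]; simp only [map_sub, LinearMap.sub_apply]; omega
  have o16 : B a1 a6 = 0 := by rw [e6]; simp only [map_sub]; omega
  have o26 : B a2 a6 = 0 := by rw [e6]; simp only [map_sub]; omega
  have o36 : B a3 a6 = 0 := by rw [e6]; simp only [map_sub]; omega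
  have o46 : B a4 a6 = 0 := by rw [e6]; simp only [map_sub]; omega
  have o56 : B a5 a6 = 0 := by rw [e6]; simp only [map_sub]; omega
  have sw : ∀ {x y}, B x y = 0 → B y x = 0 := fun {x y} hxy => by rw [h.symm]; exact hxy
  refine ⟨![a1, a2, a3, a4, a5, a6], ?_⟩
  intro i j
  fin_cases i <;> fin_cases j <;> first | assumption | (apply sw; assumption)

lemma ON.drop (h : PD B) {n : ℕ} {a : Fin (n + 1) → V} (ha : ON B a) {e : V} (he : B e e = 1) :
    ∃ i : Fin (n + 1), ON B (a ∘ i.succAbove) ∧ ∀ j, B e (a (i.succAbove j)) = 0 := by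
  have on : ∀ i : Fin (n + 1), ON B (a ∘ i.succAbove) := by
    intro i j k
    have := ha (i.succAbove j) (i.succAbove k)
    simpa using this
  by_cases hall : ∀ i, B e (a i) = 0
  · exact ⟨0, on 0, fun j => hall _⟩
  · push Not at hall
    obtain ⟨i, hi⟩ := hall
    refine ⟨i, on i, fun j => ?_⟩
    have hne := ha i (i.succAbove j)
    rw [if_neg (Fin.succAbove_ne i j).symm] at hne
    have hii := ha i i
    rw [if_pos rfl] at hii
    rcases h.unit_unit he hii with h1 | h1 | h1
    · exact absurd h1 hi
    · rw [← h1]; exact hne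
    · rw [h1] at hne
      simpa using hne

end Lattice

lemma rank_lemma (B : LinearMap.BilinForm ℤ (Fin 7 → ℤ)) (u : Fin 7 → Fin 7 → ℤ)
    (hdet : (Matrix.of fun i j => B (u i) (u j)).det ≠ 0) (n : Fin 7 → ℤ)
    (hn : ∀ i, B (u i) n = 0) : n = 0 := by
  have hB : ∀ x y, B x y = x ⬝ᵥ (LinearMap.BilinForm.toMatrix' B).mulVec y := by
    intro x y
    rw [← Matrix.toBilin'_apply', Matrix.toBilin'_toMatrix']
  set L := LinearMap.BilinForm.toMatrix' B
  set U : Matrix (Fin 7) (Fin 7) ℤ := Matrix.of u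
  have e : (Matrix.of fun i j => B (u i) (u j)) = U * L * Uᵀ := by
    ext i j
    rw [Matrix.mul_assoc, Matrix.of_apply, hB]
    rfl
  rw [e, Matrix.det_mul] at hdet
  refine Matrix.eq_zero_of_mulVec_eq_zero (left_ne_zero_of_mul hdet) ?_
  ext i
  rw [← Matrix.mulVec_mulVec]
  have := hn i
  rw [hB] at this
  exact this

lemma ON.cons {V : Type*} [AddCommGroup V] {B : LinearMap.BilinForm ℤ V} (h : PD B) {n : ℕ}
    {a : Fin n → V} (ha : ON B a) {e : V} (he : B e e = 1) (hea : ∀ i, B e (a i) = 0) :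
    ON B (Fin.cons e a : Fin (n + 1) → V) := by
  intro i j
  refine Fin.cases ?_ (fun i => ?_) i <;> refine Fin.cases ?_ (fun j => ?_) j
  · simpa using he
  · simpa [(Fin.succ_ne_zero j).symm] using hea j
  · simpa [h.symm (a i) e] using hea i
  · simpa using ha i j

lemma rank_one {B : LinearMap.BilinForm ℤ (Fin 7 → ℤ)} (h : PD B) {u : Fin 6 → Fin 7 → ℤ}
    (hu : ON B u) (m n : Fin 7 → ℤ) (hm : ∀ i, B (u i) m = 0) (hn : ∀ i, B (u i) n = 0) :
    B m m • n = B m n • m := by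
  by_cases h0 : m = 0
  · simp [h0]
  have hpos := h.pos m h0
  have hdet : (Matrix.of fun i j => B ((Fin.cons m u : Fin 7 → Fin 7 → ℤ) i)
      ((Fin.cons m u : Fin 7 → Fin 7 → ℤ) j)).det ≠ 0 := by
    have e : (Matrix.of fun i j => B ((Fin.cons m u : Fin 7 → Fin 7 → ℤ) i)
        ((Fin.cons m u : Fin 7 → Fin 7 → ℤ) j)) =
        Matrix.diagonal (Fin.cons (B m m) (fun _ => 1) : Fin 7 → ℤ) := by
      ext i j
      rw [Matrix.of_apply, Matrix.diagonal_apply]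
      refine Fin.cases ?_ (fun i => ?_) i <;> refine Fin.cases ?_ (fun j => ?_) j
      · simp
      · simpa [(Fin.succ_ne_zero j).symm, h.symm m] using hm j
      · simpa using hm i
      · simpa using hu i j
    rw [e, Matrix.det_diagonal, Fin.prod_univ_succ]
    simp [hpos.ne']
  have := rank_lemma B (Fin.cons m u) hdet (B m m • n - B m n • m) (by
    intro i
    refine Fin.cases ?_ (fun i => ?_) i
    · simp [-zsmul_eq_mul, mul_comm]
    · simp [-zsmul_eq_mul, hm, hn])
  exact sub_eq_zero.mp this

/-- `L ≅ I₆ ⊥ ⟨a⟩` is impossible. -/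
lemma caseB {B : LinearMap.BilinForm ℤ (Fin 7 → ℤ)} (h : PD B) {a : Fin 6 → Fin 7 → ℤ}
    (ha : ON B a) (e1 e2 k1 k2 w : Fin 7 → ℤ) (h11 : B e1 e1 = 1) (h22 : B e2 e2 = 1)
    (h12 : B e1 e2 = 0) (g1 : B e1 k1 = 0) (g2 : B e1 k2 = 0) (g3 : B e1 w = 0)
    (f1 : B e2 k1 = 0) (f2 : B e2 k2 = 0) (f3 : B e2 w = 0)
    (hk1 : B k1 k1 = 4) (hk2 : B k2 k2 = 4) (hk : B k1 k2 = 1) (hw : B w w = 105)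
    (hw1 : B k1 w = 0) (hw2 : B k2 w = 0) : False := by
  obtain ⟨i, oi, hi⟩ := ha.drop h h11
  obtain ⟨j, oj, hj⟩ := oi.drop h h22
  obtain ⟨v, hv⟩ : ∃ v, v = (a ∘ i.succAbove) ∘ j.succAbove := ⟨_, rfl⟩
  rw [← hv] at oj
  have v1 : ∀ l, B e1 (v l) = 0 := fun l => by rw [hv]; exact hi _
  have v2 : ∀ l, B e2 (v l) = 0 := fun l => by rw [hv]; exact hj _
  have o5 := oj.cons h h22 v2
  have o6 := o5.cons h h11 (by
    intro l
    refine Fin.cases ?_ (fun l => ?_) l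
    · simpa using h12
    · simpa using v1 l)
  obtain ⟨N, hN⟩ : ∃ N : (Fin 7 → ℤ) → (Fin 7 → ℤ),
      ∀ k, N k = k - ∑ l, B k (v l) • v l := ⟨_, fun _ => rfl⟩
  have Nv : ∀ k l, B (v l) (N k) = 0 := by
    intro k l
    rw [hN]
    simp [-zsmul_eq_mul, oj l, h.symm k]
  have Ne : ∀ k, B e1 k = 0 → B e2 k = 0 → ∀ l, B ((Fin.cons e1
      (Fin.cons e2 v : Fin 5 → Fin 7 → ℤ) : Fin 6 → Fin 7 → ℤ) l) (N k) = 0 := by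
    intro k hk1 hk2 l
    refine Fin.cases ?_ (fun l => ?_) l
    · simp [-zsmul_eq_mul, hN, v1, hk1]
    refine Fin.cases ?_ (fun l => ?_) l
    · simp [-zsmul_eq_mul, hN, v2, hk2]
    · simpa using Nv k l
  have NN : ∀ k l, B (N k) (N l) = B k l - (B k (v 0) * B l (v 0) + B k (v 1) * B l (v 1) +
      B k (v 2) * B l (v 2) + B k (v 3) * B l (v 3)) := by
    intro k l
    have : B (N k) (N l) = B k (N l) := by
      rw [hN k]
      simp [-zsmul_eq_mul, Nv]
    rw [this, hN l]
    simp [-zsmul_eq_mul, Fin.sum_univ_four]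
    ring
  have r12 := rank_one h o6 (N k1) (N k2) (Ne k1 g1 f1) (Ne k2 g2 f2)
  have r13 := rank_one h o6 (N k1) (N w) (Ne k1 g1 f1) (Ne w g3 f3)
  have r23 := rank_one h o6 (N k2) (N w) (Ne k2 g2 f2) (Ne w g3 f3)
  have q12 := congrArg (fun t => B t (N k2)) r12
  have q123 := congrArg (fun t => B t (N w)) r12
  have q13 := congrArg (fun t => B t (N w)) r13
  have q23 := congrArg (fun t => B t (N w)) r23
  simp only [map_smul, LinearMap.smul_apply, smul_eq_mul] at q12 q123 q13 q23
  refine numeric (B k1 (v 0)) (B k1 (v 1)) (B k1 (v 2)) (B k1 (v 3))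
    (B k2 (v 0)) (B k2 (v 1)) (B k2 (v 2)) (B k2 (v 3))
    (B w (v 0)) (B w (v 1)) (B w (v 2)) (B w (v 3))
    (B (N k1) (N k1)) (B (N k2) (N k2)) (B (N w) (N w)) (B (N k1) (N k2)) (B (N k1) (N w))
    (B (N k2) (N w)) ?_ ?_ ?_ ?_ ?_ ?_ (h.nonneg _) (h.nonneg _) ?_ ?_ ?_ ?_
  · rw [NN, hk1]; ring
  · rw [NN, hk2]; ring
  · rw [NN, hw]; ring
  · rw [NN, hk]
  · rw [NN, hw1]; ring
  · rw [NN, hw2]; ring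
  · rw [q12]; ring
  · rw [q13]; ring
  · rw [q23]; ring
  · exact q123

/-- `A₅` orthogonal to `I₂` is impossible: then `w` lies in `A₅`, which is even. -/
lemma caseA {B : LinearMap.BilinForm ℤ (Fin 7 → ℤ)} (h : PD B)
    (e1 e2 w r1 r2 r3 r4 r5 : Fin 7 → ℤ) (m11 : B e1 e1 = 1) (m22 : B e2 e2 = 1)
    (m12 : B e1 e2 = 0) (g3 : B e1 w = 0) (f3 : B e2 w = 0) (hw : B w w = 105)
    (h11 : B r1 r1 = 2) (h22 : B r2 r2 = 2) (h33 : B r3 r3 = 2) (h44 : B r4 r4 = 2)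
    (h55 : B r5 r5 = 2) (h12 : B r1 r2 = -1) (h23 : B r2 r3 = -1) (h34 : B r3 r4 = -1)
    (h45 : B r4 r5 = -1) (h13 : B r1 r3 = 0) (h14 : B r1 r4 = 0) (h15 : B r1 r5 = 0)
    (h24 : B r2 r4 = 0) (h25 : B r2 r5 = 0) (h35 : B r3 r5 = 0)
    (p1 : B e1 r1 = 0) (p2 : B e1 r2 = 0) (p3 : B e1 r3 = 0) (p4 : B e1 r4 = 0)
    (p5 : B e1 r5 = 0) (q1 : B e2 r1 = 0) (q2 : B e2 r2 = 0) (q3 : B e2 r3 = 0)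
    (q4 : B e2 r4 = 0) (q5 : B e2 r5 = 0) : False := by
  have sw : ∀ {x y c}, B x y = c → B y x = c := fun {x y c} hxy => by rw [h.symm]; exact hxy
  have hG : (Matrix.of fun i j => B ((![e1, e2, r1, r2, r3, r4, r5] : Fin 7 → Fin 7 → ℤ) i)
      ((![e1, e2, r1, r2, r3, r4, r5] : Fin 7 → Fin 7 → ℤ) j)) =
      !![1, 0, 0, 0, 0, 0, 0;
         0, 1, 0, 0, 0, 0, 0;
         0, 0, 2, -1, 0, 0, 0;
         0, 0, -1, 2, -1, 0, 0;
         0, 0, 0, -1, 2, -1, 0;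
         0, 0, 0, 0, -1, 2, -1;
         0, 0, 0, 0, 0, -1, 2] := by
    ext i j
    fin_cases i <;> fin_cases j <;> first | assumption | (apply sw; assumption)
  have hdet : (Matrix.of fun i j => B ((![e1, e2, r1, r2, r3, r4, r5] : Fin 7 → Fin 7 → ℤ) i)
      ((![e1, e2, r1, r2, r3, r4, r5] : Fin 7 → Fin 7 → ℤ) j)).det ≠ 0 := by
    rw [hG]
    have hinv : !![1, 0, 0, 0, 0, 0, 0;
         0, 1, 0, 0, 0, 0, 0;
         0, 0, 2, -1, 0, 0, 0;
         0, 0, -1, 2, -1, 0, 0;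
         0, 0, 0, -1, 2, -1, 0;
         0, 0, 0, 0, -1, 2, -1;
         0, 0, 0, 0, 0, -1, (2 : ℤ)] *
        !![6, 0, 0, 0, 0, 0, 0;
         0, 6, 0, 0, 0, 0, 0;
         0, 0, 5, 4, 3, 2, 1;
         0, 0, 4, 8, 6, 4, 2;
         0, 0, 3, 6, 9, 6, 3;
         0, 0, 2, 4, 6, 8, 4;
         0, 0, 1, 2, 3, 4, 5] = Matrix.diagonal (fun _ => 6) := by
      ext i j
      fin_cases i <;> fin_cases j <;> simp [Matrix.mul_apply, Fin.sum_univ_succ]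
    have := congrArg Matrix.det hinv
    rw [Matrix.det_mul, Matrix.det_diagonal] at this
    intro h0
    rw [h0] at this
    simp at this
  obtain ⟨a, ha⟩ : ∃ a, B r1 w = a := ⟨_, rfl⟩
  obtain ⟨b, hb⟩ : ∃ a, B r2 w = a := ⟨_, rfl⟩
  obtain ⟨c, hc⟩ : ∃ a, B r3 w = a := ⟨_, rfl⟩
  obtain ⟨d, hd⟩ : ∃ a, B r4 w = a := ⟨_, rfl⟩
  obtain ⟨e, he⟩ : ∃ a, B r5 w = a := ⟨_, rfl⟩
  have hn := rank_lemma B _ hdet ((6 : ℤ) • w - (5 * a + 4 * b + 3 * c + 2 * d + e) • r1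
    - (4 * a + 8 * b + 6 * c + 4 * d + 2 * e) • r2 - (3 * a + 6 * b + 9 * c + 6 * d + 3 * e) • r3
    - (2 * a + 4 * b + 6 * c + 8 * d + 4 * e) • r4 - (a + 2 * b + 3 * c + 4 * d + 5 * e) • r5) (by
    intro i
    fin_cases i <;> simp only [map_sub, map_smul, smul_eq_mul]
    · change 6 * B e1 w - _ * B e1 r1 - _ * B e1 r2 - _ * B e1 r3 - _ * B e1 r4 - _ * B e1 r5 = 0
      rw [g3, p1, p2, p3, p4, p5]; ring
    · change 6 * B e2 w - _ * B e2 r1 - _ * B e2 r2 - _ * B e2 r3 - _ * B e2 r4 - _ * B e2 r5 = 0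
      rw [f3, q1, q2, q3, q4, q5]; ring
    · change 6 * B r1 w - _ * B r1 r1 - _ * B r1 r2 - _ * B r1 r3 - _ * B r1 r4 - _ * B r1 r5 = 0
      rw [ha, h11, h12, h13, h14, h15]; ring
    · change 6 * B r2 w - _ * B r2 r1 - _ * B r2 r2 - _ * B r2 r3 - _ * B r2 r4 - _ * B r2 r5 = 0
      rw [hb, sw h12, h22, h23, h24, h25]; ring
    · change 6 * B r3 w - _ * B r3 r1 - _ * B r3 r2 - _ * B r3 r3 - _ * B r3 r4 - _ * B r3 r5 = 0
      rw [hc, sw h13, sw h23, h33, h34, h35]; ring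
    · change 6 * B r4 w - _ * B r4 r1 - _ * B r4 r2 - _ * B r4 r3 - _ * B r4 r4 - _ * B r4 r5 = 0
      rw [hd, sw h14, sw h24, sw h34, h44, h45]; ring
    · change 6 * B r5 w - _ * B r5 r1 - _ * B r5 r2 - _ * B r5 r3 - _ * B r5 r4 - _ * B r5 r5 = 0
      rw [he, sw h15, sw h25, sw h35, sw h45, h55]; ring)
  have hz := congrArg (fun t => B w t) hn
  simp only [map_sub, map_smul, smul_eq_mul, map_zero] at hz
  rw [hw, sw ha, sw hb, sw hc, sw hd, sw he] at hz
  obtain ⟨j, hj⟩ : ∃ j, j = a + 2 * b + 3 * c + 4 * d + 5 * e := ⟨_, rfl⟩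
  obtain ⟨m, hm⟩ : ∃ m, m = b ^ 2 + 3 * c ^ 2 + 6 * d ^ 2 + 10 * e ^ 2 + a * b + 2 * (a * c) +
    3 * (a * d) + 4 * (a * e) + 4 * (b * c) + 6 * (b * d) + 8 * (b * e) + 9 * (c * d) +
    12 * (c * e) + 16 * (d * e) := ⟨_, rfl⟩
  have key : 5 * j ^ 2 - 12 * m = 630 := by
    rw [hj, hm]; linear_combination -hz
  rcases Int.even_or_odd j with hjp | hjp
  · obtain ⟨t, rfl⟩ := hjp
    have : 5 * (4 * t ^ 2) - 12 * m = 630 := by linarith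
    omega
  · have := Int.sq_mod_four_eq_one_of_odd hjp
    omega

/-- No positive definite integral quadratic form of rank 7 represents both A₅ and
I₂ ⊥ K ⊥ ⟨105⟩; consequently κ(5,7) = 1. -/
theorem no_rank_seven_represents_A5_and_ell2 :
    ¬ ∃ L : Matrix (Fin 7) (Fin 7) ℤ, IsPDForm L ∧ Represents L A5 ∧ Represents L ell2 := by
  rintro ⟨L, ⟨hsymm, hpos⟩, ⟨T, hT⟩, ⟨S, hS⟩⟩
  have hB : ∀ x y, Matrix.toBilin' L x y = x ⬝ᵥ L.mulVec y := fun x y => Matrix.toBilin'_apply' L x y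
  have pd : PD (Matrix.toBilin' L) := by
    constructor
    · intro x y
      rw [hB, hB, Matrix.dotProduct_mulVec, ← Matrix.mulVec_transpose, hsymm.eq, dotProduct_comm]
    · intro x hx
      rw [hB]
      exact hpos x hx
  have gram : ∀ (T : Matrix (Fin 7) (Fin 5) ℤ) (N : Matrix (Fin 5) (Fin 5) ℤ), Tᵀ * L * T = N →
      ∀ i j, Matrix.toBilin' L (Tᵀ i) (Tᵀ j) = N i j := by
    intro T N hN i j
    rw [hB, ← hN, Matrix.mul_assoc]
    rfl
  have gT := gram T A5 hT
  have gS := gram S ell2 hS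
  obtain ⟨B, hBB⟩ : ∃ B, B = Matrix.toBilin' L := ⟨_, rfl⟩
  rw [← hBB] at pd gT gS
  have nosplit : ¬ Split B (Tᵀ 0) := by
    intro hs
    obtain ⟨a, ha⟩ := six pd (Tᵀ 0) (Tᵀ 1) (Tᵀ 2) (Tᵀ 3) (Tᵀ 4) (gT 0 0) (gT 1 1) (gT 2 2) (gT 3 3)
      (gT 4 4) (gT 0 1) (gT 1 2) (gT 2 3) (gT 3 4) (gT 0 2) (gT 0 3) (gT 0 4) (gT 1 3) (gT 1 4)
      (gT 2 4) hs
    exact caseB pd ha (Sᵀ 0) (Sᵀ 1) (Sᵀ 2) (Sᵀ 3) (Sᵀ 4) (gS 0 0) (gS 1 1) (gS 0 1)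
      (gS 0 2) (gS 0 3) (gS 0 4) (gS 1 2) (gS 1 3) (gS 1 4) (gS 2 2) (gS 3 3) (gS 2 3) (gS 4 4)
      (gS 2 4) (gS 3 4)
  have no1 : ¬ Split B (Tᵀ 1) := fun hs => nosplit (hs.next pd (gT 1 1) (gT 1 0))
  have no2 : ¬ Split B (Tᵀ 2) := fun hs => no1 (hs.next pd (gT 2 2) (gT 2 1))
  have no3 : ¬ Split B (Tᵀ 3) := fun hs => no2 (hs.next pd (gT 3 3) (gT 3 2))
  have no4 : ¬ Split B (Tᵀ 4) := fun hs => no3 (hs.next pd (gT 4 4) (gT 4 3))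
  have orth : ∀ {u r}, B u u = 1 → ¬ Split B r → B u r = 0 := by
    intro u r hu hr
    by_contra hne
    exact hr ⟨u, hu, hne⟩
  have s0 : B (Sᵀ 0) (Sᵀ 0) = 1 := gS 0 0
  have s1 : B (Sᵀ 1) (Sᵀ 1) = 1 := gS 1 1
  exact caseA pd (Sᵀ 0) (Sᵀ 1) (Sᵀ 4) (Tᵀ 0) (Tᵀ 1) (Tᵀ 2) (Tᵀ 3) (Tᵀ 4) s0 s1 (gS 0 1)
    (gS 0 4) (gS 1 4) (gS 4 4) (gT 0 0) (gT 1 1) (gT 2 2) (gT 3 3)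
    (gT 4 4) (gT 0 1) (gT 1 2) (gT 2 3) (gT 3 4) (gT 0 2) (gT 0 3) (gT 0 4) (gT 1 3) (gT 1 4)
    (gT 2 4) (orth s0 nosplit) (orth s0 no1) (orth s0 no2) (orth s0 no3) (orth s0 no4)
    (orth s1 nosplit) (orth s1 no1) (orth s1 no2) (orth s1 no3) (orth s1 no4)
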